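/- Let G be a finite simple graph, Γ ⊆ Ω(G), and let Γ' be a nonempty subfamily of MaxCritIndep(G) such that for every A ∈ Γ' there exists S ∈ Γ with A ⊆ S. If ⋃Γ' = ⋃Γ, then G is a König-Egerváry graph. -/

import Mathlib

/-- `S` is an independent set in `G`: no two of its vertices are adjacent. -/
def IndepSet {V : Type*} (G : SimpleGraph V) (S : Set V) : Prop :=
  ∀ ⦃u⦄, u ∈ S → ∀ ⦃v⦄, v ∈ S → ¬G.Adj u v

/-- The independence number `α(G)`. -/
noncomputable def indNum {V : Type*} (G : SimpleGraph V) : ℕ :=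
  sSup {n : ℕ | ∃ S : Set V, IndepSet G S ∧ S.ncard = n}

/-- `Ω(G)`: the family of maximum independent sets of `G`. -/
def maxIndepFam {V : Type*} (G : SimpleGraph V) : Set (Set V) :=
  {S | IndepSet G S ∧ S.ncard = indNum G}

/-- `N(X)`: the neighborhood of a set of vertices. -/
def nbhd {V : Type*} (G : SimpleGraph V) (X : Set V) : Set V :=
  {v | ∃ x ∈ X, G.Adj v x}

/-- `N[X] = N(X) ∪ X`: the closed neighborhood of a set of vertices. -/
def closedNbhd {V : Type*} (G : SimpleGraph V) (X : Set V) : Set V :=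
  nbhd G X ∪ X

/-- The difference `d(X) = |X| - |N(X)|`. -/
noncomputable def diffd {V : Type*} (G : SimpleGraph V) (X : Set V) : ℤ :=
  (X.ncard : ℤ) - ((nbhd G X).ncard : ℤ)

/-- The critical difference `d(G) = max {d(X) : X ⊆ V(G)}`. -/
noncomputable def critDiff {V : Type*} (G : SimpleGraph V) : ℤ :=
  sSup {d : ℤ | ∃ X : Set V, diffd G X = d}

/-- `X` is a critical set if `d(X) = d(G)`. -/
def IsCritical {V : Type*} (G : SimpleGraph V) (X : Set V) : Prop :=
  diffd G X = critDiff G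

/-- `MaxCritIndep(G)`: the family of critical independent sets of maximum cardinality. -/
def maxCritIndepFam {V : Type*} (G : SimpleGraph V) : Set (Set V) :=
  {S | IndepSet G S ∧ IsCritical G S ∧
    ∀ T : Set V, IndepSet G T → IsCritical G T → T.ncard ≤ S.ncard}

/-- The critical independence number `α'(G)`. -/
noncomputable def critIndNum {V : Type*} (G : SimpleGraph V) : ℕ :=
  sSup {n : ℕ | ∃ S : Set V, IndepSet G S ∧ IsCritical G S ∧ S.ncard = n}

/-- `ker(G)`: the intersection of all critical independent sets. -/
def kerSet {V : Type*} (G : SimpleGraph V) : Set V :=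
  ⋂₀ {A : Set V | IndepSet G A ∧ IsCritical G A}

/-- `nucleus(G)`: the intersection of all maximum critical independent sets. -/
def nucleus {V : Type*} (G : SimpleGraph V) : Set V :=
  ⋂₀ maxCritIndepFam G

/-- `diadem(G)`: the union of all maximum critical independent sets. -/
def diadem {V : Type*} (G : SimpleGraph V) : Set V :=
  ⋃₀ maxCritIndepFam G

/-- `core(G)`: the intersection of all maximum independent sets. -/
def coreSet {V : Type*} (G : SimpleGraph V) : Set V :=
  ⋂₀ maxIndepFam G

/-- `corona(G)`: the union of all maximum independent sets. -/
def coronaSet {V : Type*} (G : SimpleGraph V) : Set V :=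
  ⋃₀ maxIndepFam G

/-- A matching in `G`: a set of pairwise non-incident edges of `G`. -/
def IsMatchingSet {V : Type*} (G : SimpleGraph V) (M : Set (Sym2 V)) : Prop :=
  M ⊆ G.edgeSet ∧ M.Pairwise fun e f => ∀ v, v ∈ e → v ∉ f

/-- The matching number `μ(G)`. -/
noncomputable def matchNum {V : Type*} (G : SimpleGraph V) : ℕ :=
  sSup {n : ℕ | ∃ M : Set (Sym2 V), IsMatchingSet G M ∧ M.ncard = n}

/-- `G` is a König-Egerváry graph if `α(G) + μ(G) = |V(G)|`. -/
def IsKonigEgervary {V : Type*} (G : SimpleGraph V) : Prop :=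
  indNum G + matchNum G = Nat.card V

/-- `Γ` is a König-Egerváry collection: a family of independent sets with
`|⋂Γ| + |⋃Γ| = 2α(G)`. -/
def IsKECollection {V : Type*} (G : SimpleGraph V) (Γ : Set (Set V)) : Prop :=
  (∀ S ∈ Γ, IndepSet G S) ∧ (⋂₀ Γ).ncard + (⋃₀ Γ).ncard = 2 * indNum G

theorem diffd_le_critDiff {V : Type*} [Finite V] (G : SimpleGraph V) (X : Set V) :
    diffd G X ≤ critDiff G :=
  le_csSup (Set.finite_range (diffd G)).bddAbove ⟨X, rfl⟩

theorem nbhd_mono {V : Type*} (G : SimpleGraph V) {X Y : Set V} (h : X ⊆ Y) :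
    nbhd G X ⊆ nbhd G Y :=
  fun _ ⟨x, hx, hvx⟩ => ⟨x, h hx, hvx⟩

theorem nbhd_union {V : Type*} (G : SimpleGraph V) (X Y : Set V) :
    nbhd G (X ∪ Y) = nbhd G X ∪ nbhd G Y := by
  ext v
  simp only [nbhd, Set.mem_ofPred_eq, Set.mem_union]
  grind

/-- The difference function is supermodular, so critical sets are closed under union. -/
theorem IsCritical.union {V : Type*} [Finite V] {G : SimpleGraph V} {A B : Set V}
    (hA : IsCritical G A) (hB : IsCritical G B) : IsCritical G (A ∪ B) := by
  have h1 := Set.ncard_union_add_ncard_inter A B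
  have h2 := Set.ncard_union_add_ncard_inter (nbhd G A) (nbhd G B)
  have h3 : (nbhd G (A ∩ B)).ncard ≤ (nbhd G A ∩ nbhd G B).ncard :=
    Set.ncard_le_ncard (Set.subset_inter (nbhd_mono G Set.inter_subset_left)
      (nbhd_mono G Set.inter_subset_right))
  have h4 := diffd_le_critDiff G (A ∩ B)
  have h5 := diffd_le_critDiff G (A ∪ B)
  unfold IsCritical at *
  unfold diffd at *
  rw [nbhd_union] at *
  omega

/-- Hall's condition for matching `N(A)` into a critical set `A`. -/
theorem IsCritical.ncard_le_ncard_inter_nbhd {V : Type*} [Finite V] {G : SimpleGraph V}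
    {A Y : Set V} (hA : IsCritical G A) (hY : Y ⊆ nbhd G A) :
    Y.ncard ≤ (A ∩ nbhd G Y).ncard := by
  have h1 := diffd_le_critDiff G (A \ nbhd G Y)
  have h2 : nbhd G (A \ nbhd G Y) ⊆ nbhd G A \ Y := fun v ⟨x, hx, hvx⟩ =>
    ⟨⟨x, hx.1, hvx⟩, fun hv => hx.2 ⟨v, hv, hvx.symm⟩⟩
  have h3 := Set.ncard_le_ncard h2
  have h4 := Set.ncard_sdiff_add_ncard_of_subset hY
  have h5 := Set.ncard_inter_add_ncard_sdiff_eq_ncard A (nbhd G Y)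
  unfold IsCritical at hA
  unfold diffd at *
  omega

theorem IndepSet.disjoint_nbhd {V : Type*} {G : SimpleGraph V} {A : Set V}
    (hA : IndepSet G A) : Disjoint A (nbhd G A) :=
  Set.disjoint_left.2 fun _ hu ⟨_, hv, huv⟩ => hA hu hv huv

theorem indepSet_union_diff_nbhd {V : Type*} {G : SimpleGraph V} {A B : Set V}
    (hA : IndepSet G A) (hB : IndepSet G B) : IndepSet G (A ∪ (B \ nbhd G A)) := by
  rintro u (hu | hu) v (hv | hv) huv
  · exact hA hu hv huv
  · exact hv.2 ⟨u, hu, huv.symm⟩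
  · exact hu.2 ⟨v, hv, huv⟩
  · exact hB hu.1 hv.1 huv

theorem IsCritical.union_diff_nbhd {V : Type*} [Finite V] {G : SimpleGraph V} {A B : Set V}
    (hA : IsCritical G A) (hB : IsCritical G B) (hAi : IndepSet G A) :
    IsCritical G (A ∪ (B \ nbhd G A)) := by
  have hX := hA.union hB
  have h1 := hA.ncard_le_ncard_inter_nbhd (Y := B ∩ nbhd G A) Set.inter_subset_right
  have h2 := diffd_le_critDiff G (A ∪ (B \ nbhd G A))
  have hdisj := Set.disjoint_left.1 hAi.disjoint_nbhd
  have h3 : A ∪ (B \ nbhd G A) = (A ∪ B) \ (B ∩ nbhd G A) := by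
    ext v
    have := @hdisj v
    simp only [Set.mem_union, Set.mem_sdiff, Set.mem_inter_iff]
    tauto
  have h4 := Set.ncard_sdiff_add_ncard_of_subset
    (show B ∩ nbhd G A ⊆ A ∪ B from fun v hv => Or.inr hv.1)
  have h5 : nbhd G (A ∪ (B \ nbhd G A)) ⊆
      nbhd G (A ∪ B) \ (A ∩ nbhd G (B ∩ nbhd G A)) := by
    refine fun v hv => ⟨nbhd_mono G (Set.union_subset_union_right A Set.sdiff_subset) hv, ?_⟩
    rintro ⟨hvA, -⟩
    obtain ⟨x, hx | hx, hvx⟩ := hv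
    · exact hAi hvA hx hvx
    · exact hx.2 ⟨v, hvA, hvx.symm⟩
  have h6 := Set.ncard_le_ncard h5
  have h7 := Set.ncard_sdiff_add_ncard_of_subset
    (show A ∩ nbhd G (B ∩ nbhd G A) ⊆ nbhd G (A ∪ B) from fun v hv =>
      nbhd_mono G (fun x hx => Or.inr hx.1) hv.2)
  rw [← h3] at h4
  unfold IsCritical at *
  unfold diffd at *
  omega

/-- Any two maximum critical independent sets lie in each other's closed neighborhood. -/
theorem subset_closedNbhd_of_mem_maxCritIndepFam {V : Type*} [Finite V] {G : SimpleGraph V}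
    {A B : Set V} (hA : A ∈ maxCritIndepFam G) (hB : B ∈ maxCritIndepFam G) :
    B ⊆ closedNbhd G A := by
  obtain ⟨hAi, hAc, hAm⟩ := hA
  have hle := hAm _ (indepSet_union_diff_nbhd hAi hB.1) (hAc.union_diff_nbhd hB.2.1 hAi)
  have heq := Set.eq_of_subset_of_ncard_le (Set.subset_union_left (t := B \ nbhd G A)) hle
  intro v hv
  by_cases hvN : v ∈ nbhd G A
  · exact Or.inl hvN
  · exact Or.inr (heq ▸ Or.inr ⟨hv, hvN⟩)

theorem IsMatchingSet.ncard_le_ncard_compl {V : Type*} [Finite V] {G : SimpleGraph V}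
    {M : Set (Sym2 V)} {A : Set V} (hM : IsMatchingSet G M) (hA : IndepSet G A) :
    M.ncard ≤ Aᶜ.ncard := by
  have hex : ∀ e : Sym2 V, ∃ v ∈ e, e ∈ M → v ∉ A := by
    intro e
    induction e with
    | _ x y =>
      by_contra! h
      obtain ⟨he, hx⟩ := h x (Sym2.mem_mk_left x y)
      exact hA hx (h y (Sym2.mem_mk_right x y)).2 (hM.1 he)
  choose f hf hfA using hex
  refine Set.ncard_le_ncard_of_injOn f hfA fun e he e' he' hee => ?_
  by_contra hne
  exact hM.2 he he' hne (f e) (hf e) (hee ▸ hf e')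

theorem IsCritical.exists_isMatchingSet {V : Type*} [Finite V] {G : SimpleGraph V}
    {A : Set V} (hA : IsCritical G A) (hAi : IndepSet G A) :
    ∃ M, IsMatchingSet G M ∧ M.ncard = (nbhd G A).ncard := by
  classical
  have := Fintype.ofFinite V
  obtain ⟨f, hf, hfm⟩ := (Finset.all_card_le_biUnion_card_iff_exists_injective
    (fun x : nbhd G A => (A ∩ nbhd G {x.1}).toFinset)).1 (by
      intro s
      have hall := hA.ncard_le_ncard_inter_nbhd (Y := Subtype.val '' (s : Set (nbhd G A)))
        (by rintro _ ⟨x, -, rfl⟩; exact x.2)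
      rw [Set.ncard_image_of_injective _ Subtype.val_injective, Set.ncard_coe_finset] at hall
      refine hall.trans ?_
      rw [← Set.ncard_coe_finset]
      refine Set.ncard_le_ncard ?_
      rintro v ⟨hv, _, ⟨x, hx, rfl⟩, hvx⟩
      simp only [Finset.mem_coe, Finset.mem_biUnion, Set.mem_toFinset]
      exact ⟨x, hx, hv, x.1, rfl, hvx⟩)
  have hfA : ∀ x, f x ∈ A := fun x => (Set.mem_toFinset.1 (hfm x)).1
  have hadj : ∀ x, G.Adj x.1 (f x) := by
    intro x
    obtain ⟨_, rfl, h⟩ := (Set.mem_toFinset.1 (hfm x)).2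
    exact h.symm
  have hne : ∀ x y : nbhd G A, x.1 ≠ f y := fun x y h =>
    Set.disjoint_left.1 hAi.disjoint_nbhd (hfA y) (h ▸ x.2)
  have hshare : ∀ (x y : nbhd G A) (v : V), v ∈ s(x.1, f x) → v ∈ s(y.1, f y) → x = y := by
    intro x y v hx hy
    rw [Sym2.mem_iff] at hx hy
    rcases hx with rfl | rfl <;> rcases hy with h | h
    · exact Subtype.ext h
    · exact (hne _ _ h).elim
    · exact (hne _ _ h.symm).elim
    · exact hf h
  refine ⟨Set.range fun x => s(x.1, f x), ⟨?_, ?_⟩, ?_⟩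
  · rintro _ ⟨x, rfl⟩
    exact hadj x
  · rintro _ ⟨x, rfl⟩ _ ⟨y, rfl⟩ hxy v hx hy
    exact hxy (by rw [hshare x y v hx hy])
  · rw [← Set.image_univ, Set.ncard_image_of_injective, Set.ncard_univ]
    · rfl
    · intro x y (hxy : s(x.1, f x) = s(y.1, f y))
      exact hshare x y x.1 (Sym2.mem_mk_left _ _) (by rw [← hxy]; exact Sym2.mem_mk_left _ _)

theorem IndepSet.ncard_le_indNum {V : Type*} [Finite V] {G : SimpleGraph V} {A : Set V}
    (hA : IndepSet G A) : A.ncard ≤ indNum G :=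
  le_csSup ⟨Nat.card V, by rintro _ ⟨S, -, rfl⟩; exact Set.ncard_le_card S⟩ ⟨A, hA, rfl⟩

/-- The complement of a maximum independent set is its neighborhood. -/
theorem compl_eq_nbhd_of_mem_maxIndepFam {V : Type*} [Finite V] {G : SimpleGraph V}
    {A : Set V} (hA : A ∈ maxIndepFam G) : Aᶜ = nbhd G A := by
  refine Set.Subset.antisymm (fun v hv => ?_) hA.1.disjoint_nbhd.subset_compl_left
  by_contra hvN
  have hi : IndepSet G (insert v A) := by
    rintro u (rfl | hu) w (rfl | hw) huw
    · exact huw.ne rfl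
    · exact hvN ⟨w, hw, huw⟩
    · exact hvN ⟨u, hu, huw.symm⟩
    · exact hA.1 hu hw huw
  have hle := hi.ncard_le_indNum
  rw [Set.ncard_insert_of_notMem hv, hA.2] at hle
  omega

/-- A graph with a critical maximum independent set is a König-Egerváry graph. -/
theorem isKonigEgervary_of_isCritical {V : Type*} [Finite V] {G : SimpleGraph V} {A : Set V}
    (hA : A ∈ maxIndepFam G) (hAc : IsCritical G A) : IsKonigEgervary G := by
  have hmax : IsGreatest {n : ℕ | ∃ M : Set (Sym2 V), IsMatchingSet G M ∧ M.ncard = n}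
      Aᶜ.ncard := by
    refine ⟨?_, ?_⟩
    · rw [compl_eq_nbhd_of_mem_maxIndepFam hA]
      exact hAc.exists_isMatchingSet hA.1
    · rintro _ ⟨M, hM, rfl⟩
      exact hM.ncard_le_ncard_compl hA.1
  rw [IsKonigEgervary, matchNum, hmax.csSup_eq, ← hA.2, Set.ncard_add_ncard_compl]

/-- If `Γ ⊆ Ω(G)`, `Γ'` is a nonempty subfamily of `MaxCritIndep(G)` such
that every `A ∈ Γ'` is contained in some `S ∈ Γ`, and `⋃Γ' = ⋃Γ`, then `G` is a
König-Egerváry graph. -/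
theorem stmt10 {V : Type*} [Fintype V] (G : SimpleGraph V)
    (Γ Γ' : Set (Set V)) (hΓ : Γ ⊆ maxIndepFam G)
    (hne' : Γ'.Nonempty) (hΓ' : Γ' ⊆ maxCritIndepFam G)
    (hcov : ∀ A ∈ Γ', ∃ S ∈ Γ, A ⊆ S)
    (hU : ⋃₀ Γ' = ⋃₀ Γ) :
    IsKonigEgervary G := by
  obtain ⟨A, hA⟩ := hne'
  obtain ⟨S, hS, hAS⟩ := hcov A hA
  have hSA : S ⊆ A := by
    intro v hv
    obtain ⟨B, hB, hvB⟩ : v ∈ ⋃₀ Γ' := hU ▸ ⟨S, hS, hv⟩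
    rcases subset_closedNbhd_of_mem_maxCritIndepFam (hΓ' hA) (hΓ' hB) hvB with hvN | hvA
    · obtain ⟨x, hx, hvx⟩ := hvN
      exact ((hΓ hS).1 hv (hAS hx) hvx).elim
    · exact hvA
  obtain rfl := hAS.antisymm hSA
  exact isKonigEgervary_of_isCritical (hΓ hS) (hΓ' hA).2.1
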